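/- Let r ∈ [-1,0), h(p∘x) = (p₁^{-r}x₁^{-r} + ⋯ + pₙ^{-r}xₙ^{-r})^{-1/r}, let f ∈ C(ℝⁿ₊) satisfy |f(x)| ≤ C_A e^{A|x|} for every A>0, and define φ(x) = (-r)^{n-1}(x₁⋯xₙ)^{-r-1} ∫_0^∞ t^{n-1} e^{-t} f(tx₁^{-r},…,txₙ^{-r}) dt and Π(p,p₀) = ∫_{ℝⁿ₊} (p₀ - h(p∘x))₊ φ(x) dx. Then ∂²Π/∂p₀² (p₁^{-1/r},…,pₙ^{-1/r},1) = ∫_{ℝⁿ₊} e^{-p·x} f(x) dx for all p > 0. -/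

import Mathlib

open MeasureTheory Real Set

/-- Two weighted measures whose push-forwards agree on nonnegative functions also integrate real
functions in the same way. -/
theorem integrable_and_integral_eq_of_lintegral_eq {α β γ : Type*} [MeasurableSpace α]
    [MeasurableSpace β] [MeasurableSpace γ] {μ : Measure α} {ν : Measure β} {k : α → ℝ}
    {l : β → ℝ} {a : α → γ} {b : β → γ} (hk : Measurable k) (hl : Measurable l)
    (hk0 : ∀ᵐ x ∂μ, 0 ≤ k x) (hl0 : ∀ᵐ y ∂ν, 0 ≤ l y) (ha : Measurable a) (hb : Measurable b)
    (h : ∀ g : γ → ENNReal, Measurable g →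
      ∫⁻ x, ENNReal.ofReal (k x) * g (a x) ∂μ = ∫⁻ y, ENNReal.ofReal (l y) * g (b y) ∂ν)
    {f : γ → ℝ} (hf : Measurable f) (hint : Integrable (fun y => l y * f (b y)) ν) :
    Integrable (fun x => k x * f (a x)) μ ∧
      ∫ x, k x * f (a x) ∂μ = ∫ y, l y * f (b y) ∂ν := by
  have hk' : Measurable fun x => ENNReal.ofReal (k x) := hk.ennreal_ofReal
  have hl' : Measurable fun y => ENNReal.ofReal (l y) := hl.ennreal_ofReal
  have hmap : (μ.withDensity fun x => ENNReal.ofReal (k x)).map a =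
      (ν.withDensity fun y => ENNReal.ofReal (l y)).map b := by
    ext s hs
    have h1 : Measurable (s.indicator (1 : γ → ENNReal)) := measurable_one.indicator hs
    rw [← lintegral_indicator_one hs, ← lintegral_indicator_one hs, lintegral_map h1 ha,
      lintegral_map h1 hb]
    exact (lintegral_withDensity_eq_lintegral_mul _ hk' (h1.comp ha)).trans
      ((h _ h1).trans (lintegral_withDensity_eq_lintegral_mul _ hl' (h1.comp hb)).symm)
  have hke : (fun x => (ENNReal.ofReal (k x)).toReal • f (a x)) =ᵐ[μ] fun x => k x * f (a x) := by
    filter_upwards [hk0] with x hx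
    rw [ENNReal.toReal_ofReal hx, smul_eq_mul]
  have hle : (fun y => (ENNReal.ofReal (l y)).toReal • f (b y)) =ᵐ[ν] fun y => l y * f (b y) := by
    filter_upwards [hl0] with x hx
    rw [ENNReal.toReal_ofReal hx, smul_eq_mul]
  have hfin : ∀ᵐ x ∂μ, ENNReal.ofReal (k x) < ⊤ := ae_of_all _ fun _ => ENNReal.ofReal_lt_top
  have hfin' : ∀ᵐ x ∂ν, ENNReal.ofReal (l x) < ⊤ := ae_of_all _ fun _ => ENNReal.ofReal_lt_top
  constructor
  · rw [← integrable_congr hke, ← integrable_withDensity_iff_integrable_smul' hk' hfin]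
    have := (integrable_map_measure (μ := μ.withDensity fun x => ENNReal.ofReal (k x))
      hf.aestronglyMeasurable ha.aemeasurable).1
    refine this ?_
    rw [hmap, integrable_map_measure hf.aestronglyMeasurable hb.aemeasurable,
      integrable_withDensity_iff_integrable_smul' hl' hfin']
    exact (integrable_congr hle).2 hint
  · rw [← integral_congr_ae hke, ← integral_congr_ae hle,
      ← integral_withDensity_eq_integral_toReal_smul hk' hfin (fun x => f (a x)),
      ← integral_withDensity_eq_integral_toReal_smul hl' hfin' (fun y => f (b y)),
      ← integral_map ha.aemeasurable hf.aestronglyMeasurable, hmap,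
      integral_map hb.aemeasurable hf.aestronglyMeasurable]

theorem lintegral_Ioi_profit_kernel {s q : ℝ} (hs : 0 < s) (hq : 0 < q) (c : ℝ) :
    ∫⁻ t in Ioi (0 : ℝ),
        ENNReal.ofReal (s⁻¹ * t⁻¹ * exp (-t) * max (c - (q / t) ^ (1 / s)) 0) =
      ∫⁻ v in Ioi (0 : ℝ), ENNReal.ofReal (v⁻¹ * exp (-q * v ^ (-s)) * max (c - v) 0) := by
  have himg : (fun v : ℝ => q * v ^ (-s)) '' Ioi 0 = Ioi 0 := by
    ext t
    simp only [mem_image, mem_Ioi]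
    constructor
    · rintro ⟨v, hv, rfl⟩
      positivity
    · intro ht
      refine ⟨(t / q) ^ (-s)⁻¹, by positivity, ?_⟩
      rw [← rpow_mul (by positivity), inv_mul_cancel₀ (by linarith), rpow_one]
      field_simp
  have hinj : InjOn (fun v : ℝ => q * v ^ (-s)) (Ioi 0) := by
    intro u hu v hv huv
    have := mul_left_cancel₀ hq.ne' huv
    exact (rpow_left_inj (le_of_lt hu) (le_of_lt hv) (by linarith)).1 this
  have hder : ∀ v ∈ Ioi (0 : ℝ), HasDerivWithinAt (fun v : ℝ => q * v ^ (-s))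
      (q * (-s * v ^ (-s - 1))) (Ioi 0) v := fun v hv =>
    ((hasDerivAt_rpow_const (Or.inl (ne_of_gt hv))).const_mul q).hasDerivWithinAt
  conv_lhs => rw [← himg]
  rw [lintegral_image_eq_lintegral_abs_deriv_mul measurableSet_Ioi hder hinj]
  refine setLIntegral_congr_fun measurableSet_Ioi fun v (hv : 0 < v) => ?_
  have h1 : (q / (q * v ^ (-s))) ^ (1 / s) = v := by
    rw [div_mul_cancel_left₀ hq.ne', rpow_neg hv.le, inv_inv, ← rpow_mul hv.le,
      mul_one_div_cancel hs.ne', rpow_one]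
  have h2 : |q * (-s * v ^ (-s - 1))| = q * (s * v ^ (-s - 1)) := by
    rw [show q * (-s * v ^ (-s - 1)) = -(q * (s * v ^ (-s - 1))) by ring, abs_neg,
      abs_of_pos (by positivity)]
  rw [← ENNReal.ofReal_mul (abs_nonneg _), h1, h2, rpow_sub_one hv.ne']
  congr 1
  have : v ^ (-s) ≠ 0 := (rpow_pos_of_pos hv _).ne'
  rw [neg_mul]
  field_simp

theorem lintegral_orthant_scaled_rpow {ι : Type*} [Fintype ι] {s t : ℝ} (hs : 0 < s) (ht : 0 < t)
    (g : (ι → ℝ) → ENNReal) :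
    ∫⁻ w in univ.pi fun _ : ι => Ioi (0 : ℝ), g w =
      ∫⁻ x in univ.pi fun _ : ι => Ioi (0 : ℝ),
        ENNReal.ofReal ((s * t) ^ Fintype.card ι * (∏ i, x i) ^ (s - 1)) *
          g fun i => t * x i ^ s := by
  have himg : (fun (x : ι → ℝ) i => t * x i ^ s) '' (univ.pi fun _ : ι => Ioi (0 : ℝ)) =
      univ.pi fun _ : ι => Ioi (0 : ℝ) := by
    ext w
    simp only [mem_image, mem_univ_pi, mem_Ioi]
    constructor
    · rintro ⟨x, hx, rfl⟩ i
      have := hx i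
      positivity
    · intro hw
      refine ⟨fun i => (w i / t) ^ s⁻¹, fun i => ?_, funext fun i => ?_⟩
      · have := hw i
        positivity
      · have := hw i
        rw [← rpow_mul (by positivity), inv_mul_cancel₀ hs.ne', rpow_one]
        field_simp
  have hinj : InjOn (fun (x : ι → ℝ) i => t * x i ^ s) (univ.pi fun _ : ι => Ioi (0 : ℝ)) := by
    intro u hu v hv huv
    ext i
    have := mul_left_cancel₀ ht.ne' (congrFun huv i)
    exact (rpow_left_inj (le_of_lt (hu i trivial)) (le_of_lt (hv i trivial)) hs.ne').1 this
  let D : (ι → ℝ) → (ι → ℝ) →L[ℝ] (ι → ℝ) := fun x => ContinuousLinearMap.pi fun i =>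
    (ContinuousLinearMap.toSpanSingleton ℝ (t * (s * x i ^ (s - 1)))) ∘SL
      ContinuousLinearMap.proj i
  have hder : ∀ x ∈ univ.pi fun _ : ι => Ioi (0 : ℝ),
      HasFDerivWithinAt (fun (x : ι → ℝ) i => t * x i ^ s) (D x)
        (univ.pi fun _ : ι => Ioi (0 : ℝ)) x := by
    intro x hx
    refine (hasFDerivAt_pi.2 fun i => ?_).hasFDerivWithinAt
    have h1 : HasDerivAt (fun y : ℝ => t * y ^ s) (t * (s * x i ^ (s - 1))) (x i) :=
      (hasDerivAt_rpow_const (Or.inl (ne_of_gt (hx i trivial)))).const_mul t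
    exact HasFDerivAt.comp (g := fun y : ℝ => t * y ^ s) x h1.hasFDerivAt
      (ContinuousLinearMap.proj (R := ℝ) (φ := fun _ : ι => ℝ) i).hasFDerivAt
  conv_lhs => rw [← himg]
  rw [lintegral_image_eq_lintegral_abs_det_fderiv_mul volume
    (MeasurableSet.univ_pi fun _ => measurableSet_Ioi) hder hinj]
  refine setLIntegral_congr_fun (MeasurableSet.univ_pi fun _ => measurableSet_Ioi) fun x hx => ?_
  have hx' : ∀ i, 0 < x i := fun i => hx i trivial
  have hdet : (D x).det = ∏ i, (t * (s * x i ^ (s - 1))) := by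
    simp only [D, ContinuousLinearMap.det_pi]
    refine Finset.prod_congr rfl fun i _ => ?_
    simp [ContinuousLinearMap.det]
  have hprod : ∏ i, (t * (s * x i ^ (s - 1))) =
      (s * t) ^ Fintype.card ι * (∏ i, x i) ^ (s - 1) := by
    rw [← finsetProd_rpow _ _ fun i _ => (hx' i).le, ← Finset.card_univ, ← Finset.prod_const,
      ← Finset.prod_mul_distrib]
    exact Finset.prod_congr rfl fun i _ => by ring
  have hpos : 0 ≤ ∏ i, (t * (s * x i ^ (s - 1))) := Finset.prod_nonneg fun i _ => by
    have := hx' i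
    positivity
  rw [hdet, abs_of_nonneg hpos, hprod]

theorem hasDerivAt_integral_sub_mul {G : ℝ → ℝ} {a : ℝ} (hG : IntervalIntegrable G volume 0 a)
    (hm : StronglyMeasurableAtFilter G (nhds a)) (hc : ContinuousAt G a)
    (ha : ∀ᶠ u in nhds a, IntervalIntegrable G volume 0 u) :
    HasDerivAt (fun u => ∫ v in (0 : ℝ)..u, (u - v) * G v) (∫ v in (0 : ℝ)..a, G v) a := by
  have h1 := intervalIntegral.integral_hasDerivAt_right hG hm hc
  have hG' : IntervalIntegrable (fun v => v * G v) volume 0 a :=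
    hG.continuousOn_mul continuousOn_id
  obtain ⟨t, ht, hmt⟩ := hm
  have h2 := intervalIntegral.integral_hasDerivAt_right hG'
    ⟨t, ht, continuous_id.aestronglyMeasurable.mul hmt⟩ (continuousAt_id.mul hc)
  have h3 := ((hasDerivAt_id a).mul h1).sub h2
  refine (h3.congr_of_eventuallyEq ?_).congr_deriv ?_
  · filter_upwards [ha] with u hu
    have hu' : IntervalIntegrable (fun v => v * G v) volume 0 u :=
      hu.continuousOn_mul continuousOn_id
    simp only [sub_mul, Pi.sub_apply, Pi.mul_apply, id]
    rw [intervalIntegral.integral_sub (hu.const_mul u) hu', intervalIntegral.integral_const_mul]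
  · simp

theorem integrableOn_and_integral_exp_orthant {ι : Type*} [Fintype ι] {p : ι → ℝ} (hp : ∀ i, 0 < p i) {c : ℝ} (hc : 0 < c) :
    IntegrableOn (fun w : ι → ℝ => exp (-(∑ i, p i * w i) * c))
        (univ.pi fun _ : ι => Ioi (0 : ℝ)) ∧
      ∫ w in univ.pi fun _ : ι => Ioi (0 : ℝ), exp (-(∑ i, p i * w i) * c) =
        (∏ i, (p i)⁻¹) * c⁻¹ ^ Fintype.card ι := by
  have hfun : (fun w : ι → ℝ => exp (-(∑ i, p i * w i) * c)) =
      fun w => ∏ i, exp (-(p i * c) * w i) := by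
    ext w
    rw [← exp_sum, neg_mul, Finset.sum_mul, ← Finset.sum_neg_distrib]
    exact congrArg _ (Finset.sum_congr rfl fun i _ => by ring)
  have hneg : ∀ i, -(p i * c) < 0 := fun i => neg_lt_zero.2 (mul_pos (hp i) hc)
  rw [IntegrableOn, hfun, volume_pi, Measure.restrict_pi_pi]
  refine ⟨Integrable.fintype_prod (f := fun i x => exp (-(p i * c) * x))
    fun i => integrableOn_exp_mul_Ioi (hneg i) 0, ?_⟩
  rw [integral_fintype_prod_eq_prod (fun i x => exp (-(p i * c) * x)), ← Finset.card_univ,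
    ← Finset.prod_const, ← Finset.prod_mul_distrib]
  refine Finset.prod_congr rfl fun i _ => ?_
  rw [integral_exp_mul_Ioi (hneg i)]
  simp [mul_comm]

theorem lintegral_ces_profit_kernel {n : ℕ} (hn : 0 < n) {s : ℝ} (hs : 0 < s) {p : Fin n → ℝ}
    (hp : ∀ i, 0 < p i) (c : ℝ) {g : (Fin n → ℝ) → ENNReal} (hg : Measurable g) :
    ∫⁻ z : (Fin n → ℝ) × ℝ,
        ENNReal.ofReal (max (c - (∑ i, p i * z.1 i ^ s) ^ (1 / s)) 0 *
          (s ^ (n - 1) * (∏ i, z.1 i) ^ (s - 1)) * (z.2 ^ (n - 1) * exp (-z.2))) *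
        g (fun i => z.2 * z.1 i ^ s)
        ∂(volume.restrict (univ.pi fun _ => Ioi 0)).prod (volume.restrict (Ioi 0)) =
      ∫⁻ z : ℝ × (Fin n → ℝ),
        ENNReal.ofReal (z.1⁻¹ * exp (-(∑ i, p i * z.2 i) * z.1 ^ (-s)) * max (c - z.1) 0) * g z.2
        ∂(volume.restrict (Ioi 0)).prod (volume.restrict (univ.pi fun _ => Ioi 0)) := by
  have hP : MeasurableSet (univ.pi fun _ : Fin n => Ioi (0 : ℝ)) :=
    MeasurableSet.univ_pi fun _ => measurableSet_Ioi
  have hfix : ∀ t ∈ Ioi (0 : ℝ),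
      ∫⁻ x in univ.pi fun _ : Fin n => Ioi (0 : ℝ),
        ENNReal.ofReal (max (c - (∑ i, p i * x i ^ s) ^ (1 / s)) 0 *
          (s ^ (n - 1) * (∏ i, x i) ^ (s - 1)) * (t ^ (n - 1) * exp (-t))) *
        g (fun i => t * x i ^ s) =
      ∫⁻ w in univ.pi fun _ : Fin n => Ioi (0 : ℝ),
        ENNReal.ofReal (s⁻¹ * t⁻¹ * exp (-t) * max (c - ((∑ i, p i * w i) / t) ^ (1 / s)) 0) *
          g w := by
    intro t (ht : 0 < t)
    conv_rhs => rw [lintegral_orthant_scaled_rpow hs ht]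
    refine setLIntegral_congr_fun hP fun x hx => ?_
    have hx' : ∀ i, 0 < x i := fun i => hx i trivial
    have hpx : 0 ≤ (∏ i, x i) ^ (s - 1) :=
      rpow_nonneg (Finset.prod_nonneg fun i _ => (hx' i).le) _
    beta_reduce
    rw [← mul_assoc (ENNReal.ofReal _), ← ENNReal.ofReal_mul (by positivity)]
    congr 2
    have hsum : (∑ i, p i * (t * x i ^ s)) / t = ∑ i, p i * x i ^ s := by
      rw [Finset.sum_div]
      exact Finset.sum_congr rfl fun i _ => by field_simp
    rw [hsum, Fintype.card_fin, mul_pow]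
    obtain ⟨m, rfl⟩ : ∃ m, n = m + 1 := ⟨n - 1, by omega⟩
    rw [Nat.add_sub_cancel, pow_succ, pow_succ]
    field_simp
  rw [lintegral_prod_symm _ (by fun_prop), setLIntegral_congr_fun measurableSet_Ioi hfix,
    lintegral_lintegral_swap (by fun_prop), lintegral_prod_symm _ (by fun_prop)]
  refine setLIntegral_congr_fun hP fun w hw => ?_
  have hq : 0 < ∑ i, p i * w i :=
    Finset.sum_pos (fun i _ => mul_pos (hp i) (hw i trivial)) ⟨⟨0, hn⟩, Finset.mem_univ _⟩
  dsimp only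
  rw [lintegral_mul_const _ (by fun_prop), lintegral_mul_const _ (by fun_prop),
    lintegral_Ioi_profit_kernel hs hq]

theorem exists_forall_abs_le_mul_exp_sum {n : ℕ} (hn : 0 < n) {f : (Fin n → ℝ) → ℝ}
    (hf : ∀ A > (0 : ℝ), ∃ C > (0 : ℝ), ∀ x : Fin n → ℝ, (∀ i, 0 ≤ x i) →
      |f x| ≤ C * exp (A * ‖x‖))
    {p : Fin n → ℝ} (hp : ∀ i, 0 < p i) {c : ℝ} (hc : 0 < c) :
    ∃ C > (0 : ℝ), ∀ w ∈ univ.pi fun _ : Fin n => Ioi (0 : ℝ),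
      |f w| ≤ C * exp ((∑ i, p i * w i) * c) := by
  have : Nonempty (Fin n) := ⟨⟨0, hn⟩⟩
  obtain ⟨j, hj⟩ := Finite.exists_min p
  obtain ⟨C, hC, h⟩ := hf (p j * c) (mul_pos (hp j) hc)
  refine ⟨C, hC, fun w hw => ?_⟩
  have hw' : ∀ i, 0 < w i := fun i => hw i trivial
  refine (h w fun i => (hw' i).le).trans (mul_le_mul_of_nonneg_left (exp_le_exp.2 ?_) hC.le)
  have hnorm : ‖w‖ ≤ (∑ i, p i * w i) / p j := by
    refine (pi_norm_le_iff_of_nonneg ?_).2 fun i => ?_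
    · exact div_nonneg (Finset.sum_nonneg fun i _ => (mul_pos (hp i) (hw' i)).le) (hp j).le
    · rw [norm_eq_abs, abs_of_pos (hw' i), le_div_iff₀ (hp j)]
      calc w i * p j ≤ p i * w i := by nlinarith [hj i, hw' i]
        _ ≤ ∑ i, p i * w i := Finset.single_le_sum (f := fun i => p i * w i)
            (fun i _ => (mul_pos (hp i) (hw' i)).le) (Finset.mem_univ i)
  rw [le_div_iff₀ (hp j)] at hnorm
  nlinarith

theorem abs_exp_mul_le {n : ℕ} {f : (Fin n → ℝ) → ℝ} {p : Fin n → ℝ} (hp : ∀ i, 0 < p i)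
    {s b C : ℝ} (hs : 0 < s)
    (hC : ∀ w ∈ univ.pi fun _ : Fin n => Ioi (0 : ℝ),
      |f w| ≤ C * exp ((∑ i, p i * w i) * (b ^ (-s) / 2)))
    {v : ℝ} (hv : 0 < v) (hvb : v ≤ b) {w : Fin n → ℝ}
    (hw : w ∈ univ.pi fun _ : Fin n => Ioi (0 : ℝ)) :
    |exp (-(∑ i, p i * w i) * v ^ (-s)) * f w| ≤
      C * exp (-(∑ i, p i * w i) * (v ^ (-s) / 2)) := by
  have hS : 0 ≤ ∑ i, p i * w i :=
    Finset.sum_nonneg fun i _ => (mul_pos (hp i) (hw i trivial)).le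
  have hle : b ^ (-s) ≤ v ^ (-s) := rpow_le_rpow_of_nonpos hv hvb (by linarith)
  have hC0 : 0 ≤ C := by
    have := (abs_nonneg _).trans (hC w hw)
    exact nonneg_of_mul_nonneg_left this (exp_pos _)
  rw [abs_mul, abs_of_pos (exp_pos _)]
  calc _ ≤ exp (-(∑ i, p i * w i) * v ^ (-s)) *
        (C * exp ((∑ i, p i * w i) * (b ^ (-s) / 2))) := by gcongr; exact hC w hw
    _ = C * exp (-(∑ i, p i * w i) * v ^ (-s) + (∑ i, p i * w i) * (b ^ (-s) / 2)) := by
        rw [exp_add]; ring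
    _ ≤ _ := by
        gcongr
        nlinarith

theorem integrable_laplace_kernel {n : ℕ} (hn : 0 < n) {s : ℝ} (hs : 0 < s)
    {f : (Fin n → ℝ) → ℝ} (hf : Continuous f) {p : Fin n → ℝ} (hp : ∀ i, 0 < p i)
    (hgrow : ∀ c > (0 : ℝ), ∃ C > (0 : ℝ), ∀ w ∈ univ.pi fun _ : Fin n => Ioi (0 : ℝ),
      |f w| ≤ C * exp ((∑ i, p i * w i) * c)) {b : ℝ} (hb : 0 < b) :
    Integrable (fun z : ℝ × (Fin n → ℝ) =>
        z.1⁻¹ * (exp (-(∑ i, p i * z.2 i) * z.1 ^ (-s)) * f z.2))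
      ((volume.restrict (Ioc 0 b)).prod (volume.restrict (univ.pi fun _ => Ioi 0))) := by
  have hP : MeasurableSet (univ.pi fun _ : Fin n => Ioi (0 : ℝ)) :=
    MeasurableSet.univ_pi fun _ => measurableSet_Ioi
  obtain ⟨C, hC0, hC⟩ := hgrow (b ^ (-s) / 2) (by positivity)
  have hfm : Measurable f := hf.measurable
  have hdom : Integrable (fun z : ℝ × (Fin n → ℝ) =>
        z.1⁻¹ * (C * exp (-(∑ i, p i * z.2 i) * (z.1 ^ (-s) / 2))))
      ((volume.restrict (Ioc 0 b)).prod (volume.restrict (univ.pi fun _ => Ioi 0))) := by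
    rw [integrable_prod_iff (by apply Measurable.aestronglyMeasurable; fun_prop)]
    constructor
    · filter_upwards [ae_restrict_mem measurableSet_Ioc] with v hv
      have := rpow_pos_of_pos hv.1 (-s)
      exact ((integrableOn_and_integral_exp_orthant hp (half_pos this)).1.const_mul C).const_mul _
    · have hint : IntegrableOn (fun v : ℝ => C * (∏ i, (p i)⁻¹) * 2 ^ n * v ^ (s * n - 1))
          (Ioc 0 b) := by
        refine Integrable.const_mul ?_ _
        have : 0 < s * n := by positivity
        exact (intervalIntegrable_iff_integrableOn_Ioc_of_le hb.le).1
          (intervalIntegral.intervalIntegrable_rpow' (by linarith))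
      refine hint.congr_fun (fun v hv => ?_) measurableSet_Ioc
      have hv0 : 0 < v := hv.1
      have := rpow_pos_of_pos hv0 (-s)
      beta_reduce
      have hnorm : ∀ w : Fin n → ℝ, ‖v⁻¹ * (C * exp (-(∑ i, p i * w i) * (v ^ (-s) / 2)))‖ =
          v⁻¹ * (C * exp (-(∑ i, p i * w i) * (v ^ (-s) / 2))) := fun w =>
        norm_of_nonneg (by positivity)
      simp_rw [hnorm]
      rw [integral_const_mul, integral_const_mul, (integrableOn_and_integral_exp_orthant hp (half_pos this)).2,
        Fintype.card_fin, rpow_sub_one hv0.ne', rpow_mul hv0.le, rpow_natCast, rpow_neg hv0.le,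
        show ((v ^ s)⁻¹ / 2)⁻¹ = 2 * v ^ s by field_simp, mul_pow]
      field_simp
  refine hdom.mono' (by apply Measurable.aestronglyMeasurable; fun_prop) ?_
  rw [Measure.prod_restrict]
  filter_upwards [ae_restrict_mem (measurableSet_Ioc.prod hP)] with z hz
  have hz0 : 0 < z.1 := hz.1.1
  rw [norm_mul, norm_of_nonneg (inv_nonneg.2 hz0.le)]
  gcongr
  exact abs_exp_mul_le hp hs hC hz.1.1 hz.1.2 hz.2

theorem continuousAt_laplace_rpow {n : ℕ} {s : ℝ} (hs : 0 < s)
    {f : (Fin n → ℝ) → ℝ} (hf : Continuous f) {p : Fin n → ℝ} (hp : ∀ i, 0 < p i)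
    (hgrow : ∀ c > (0 : ℝ), ∃ C > (0 : ℝ), ∀ w ∈ univ.pi fun _ : Fin n => Ioi (0 : ℝ),
      |f w| ≤ C * exp ((∑ i, p i * w i) * c)) {a : ℝ} (ha : 0 < a) :
    ContinuousAt (fun v : ℝ => v⁻¹ * ∫ w in univ.pi fun _ : Fin n => Ioi (0 : ℝ),
      exp (-(∑ i, p i * w i) * v ^ (-s)) * f w) a := by
  have hP : MeasurableSet (univ.pi fun _ : Fin n => Ioi (0 : ℝ)) :=
    MeasurableSet.univ_pi fun _ => measurableSet_Ioi
  have hb : 0 < 2 * a := by positivity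
  have hbs : 0 < (2 * a) ^ (-s) / 2 := by positivity
  obtain ⟨C, hC0, hC⟩ := hgrow ((2 * a) ^ (-s) / 2) hbs
  have hfm : Measurable f := hf.measurable
  refine (continuousAt_inv₀ ha.ne').mul (continuousAt_of_dominated
    (bound := fun w => C * exp (-(∑ i, p i * w i) * ((2 * a) ^ (-s) / 2))) ?_ ?_ ?_ ?_)
  · exact Filter.Eventually.of_forall fun v => by apply Measurable.aestronglyMeasurable; fun_prop
  · filter_upwards [Ioo_mem_nhds ha (by linarith : a < 2 * a)] with v hv
    filter_upwards [ae_restrict_mem hP] with w hw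
    refine (abs_exp_mul_le hp hs hC hv.1 hv.2.le hw).trans
      (mul_le_mul_of_nonneg_left (exp_le_exp.2 ?_) hC0.le)
    have hS : 0 ≤ ∑ i, p i * w i :=
      Finset.sum_nonneg fun i _ => (mul_pos (hp i) (hw i trivial)).le
    have hle : (2 * a) ^ (-s) ≤ v ^ (-s) := rpow_le_rpow_of_nonpos hv.1 hv.2.le (by linarith)
    nlinarith
  · exact (integrableOn_and_integral_exp_orthant hp hbs).1.const_mul C
  · refine ae_of_all _ fun w => ?_
    have : ContinuousAt (fun v : ℝ => v ^ (-s)) a := continuousAt_rpow_const _ _ (Or.inl ha.ne')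
    fun_prop

theorem ces_profit_eq_intervalIntegral {n : ℕ} (hn : 0 < n) {s : ℝ} (hs : 0 < s)
    {f : (Fin n → ℝ) → ℝ} (hf : Continuous f) {p : Fin n → ℝ} (hp : ∀ i, 0 < p i)
    (hgrow : ∀ c > (0 : ℝ), ∃ C > (0 : ℝ), ∀ w ∈ univ.pi fun _ : Fin n => Ioi (0 : ℝ),
      |f w| ≤ C * exp ((∑ i, p i * w i) * c)) {c : ℝ} (hc : 0 < c) :
    ∫ x in univ.pi fun _ : Fin n => Ioi (0 : ℝ),
        max (c - (∑ i, p i * x i ^ s) ^ (1 / s)) 0 * (s ^ (n - 1) * (∏ i, x i) ^ (s - 1) *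
          ∫ t in Ioi (0 : ℝ), t ^ (n - 1) * exp (-t) * f fun i => t * x i ^ s) =
      ∫ v in (0 : ℝ)..c, (c - v) * (v⁻¹ * ∫ w in univ.pi fun _ : Fin n => Ioi (0 : ℝ),
        exp (-(∑ i, p i * w i) * v ^ (-s)) * f w) := by
  have hP : MeasurableSet (univ.pi fun _ : Fin n => Ioi (0 : ℝ)) :=
    MeasurableSet.univ_pi fun _ => measurableSet_Ioi
  have hfm : Measurable f := hf.measurable
  have hint : Integrable (fun z : ℝ × (Fin n → ℝ) =>
      z.1⁻¹ * exp (-(∑ i, p i * z.2 i) * z.1 ^ (-s)) * max (c - z.1) 0 * f z.2)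
      ((volume.restrict (Ioi 0)).prod (volume.restrict (univ.pi fun _ => Ioi 0))) := by
    have h := integrable_laplace_kernel hn hs hf hp hgrow hc
    rw [Measure.prod_restrict] at h ⊢
    have h' : IntegrableOn (fun z : ℝ × (Fin n → ℝ) =>
        z.1⁻¹ * exp (-(∑ i, p i * z.2 i) * z.1 ^ (-s)) * max (c - z.1) 0 * f z.2)
        (Ioc 0 c ×ˢ univ.pi fun _ => Ioi 0) := by
      refine (h.const_mul c).mono (by apply Measurable.aestronglyMeasurable; fun_prop) ?_
      filter_upwards [ae_restrict_mem (measurableSet_Ioc.prod hP)] with z hz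
      have hz1 : 0 < z.1 := hz.1.1
      have hz2 : z.1 ≤ c := hz.1.2
      rw [show z.1⁻¹ * exp (-(∑ i, p i * z.2 i) * z.1 ^ (-s)) * max (c - z.1) 0 * f z.2 =
        max (c - z.1) 0 * (z.1⁻¹ * (exp (-(∑ i, p i * z.2 i) * z.1 ^ (-s)) * f z.2)) by ring,
        norm_mul, norm_mul c]
      gcongr
      rw [max_eq_left (by linarith), norm_of_nonneg (by linarith), norm_of_nonneg hc.le]
      linarith
    refine IntegrableOn.of_forall_sdiff_eq_zero h' (measurableSet_Ioi.prod hP) fun z hz => ?_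
    have hlt : c < z.1 := by
      by_contra! hle
      exact hz.2 ⟨⟨hz.1.1, hle⟩, hz.1.2⟩
    rw [max_eq_right (by linarith)]
    simp
  obtain ⟨hint', heq⟩ := integrable_and_integral_eq_of_lintegral_eq
    (μ := (volume.restrict (univ.pi fun _ => Ioi 0)).prod (volume.restrict (Ioi 0)))
    (ν := (volume.restrict (Ioi 0)).prod (volume.restrict (univ.pi fun _ => Ioi 0)))
    (k := fun z : (Fin n → ℝ) × ℝ => max (c - (∑ i, p i * z.1 i ^ s) ^ (1 / s)) 0 *
          (s ^ (n - 1) * (∏ i, z.1 i) ^ (s - 1)) * (z.2 ^ (n - 1) * exp (-z.2)))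
    (l := fun z : ℝ × (Fin n → ℝ) =>
      z.1⁻¹ * exp (-(∑ i, p i * z.2 i) * z.1 ^ (-s)) * max (c - z.1) 0)
    (a := fun z i => z.2 * z.1 i ^ s) (b := Prod.snd) (by fun_prop) (by fun_prop)
    (by
      rw [Measure.prod_restrict]
      filter_upwards [ae_restrict_mem (hP.prod measurableSet_Ioi)] with z hz
      have hz2 : 0 < z.2 := hz.2
      have hpx : 0 ≤ (∏ i, z.1 i) ^ (s - 1) :=
        rpow_nonneg (Finset.prod_nonneg fun i _ => le_of_lt (hz.1 i trivial)) _
      positivity)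
    (by
      rw [Measure.prod_restrict]
      filter_upwards [ae_restrict_mem (measurableSet_Ioi.prod hP)] with z hz
      have hz1 : 0 < z.1 := hz.1
      positivity)
    (by fun_prop) measurable_snd (fun g hg => lintegral_ces_profit_kernel hn hs hp c hg) hfm hint
  rw [integral_prod _ hint', integral_prod _ hint] at heq
  calc _ = _ := ?_
    _ = _ := heq
    _ = ∫ v in Ioi (0 : ℝ), max (c - v) 0 * (v⁻¹ * ∫ w in univ.pi fun _ : Fin n => Ioi (0 : ℝ),
        exp (-(∑ i, p i * w i) * v ^ (-s)) * f w) := ?_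
    _ = ∫ v in Ioc (0 : ℝ) c, max (c - v) 0 * (v⁻¹ * ∫ w in univ.pi fun _ : Fin n => Ioi (0 : ℝ),
        exp (-(∑ i, p i * w i) * v ^ (-s)) * f w) := ?_
    _ = _ := ?_
  · refine integral_congr_ae (ae_of_all _ fun x => ?_)
    beta_reduce
    rw [← mul_assoc, ← integral_const_mul]
    refine integral_congr_ae (ae_of_all _ fun t => ?_)
    beta_reduce
    ring
  · refine integral_congr_ae (ae_of_all _ fun v => ?_)
    beta_reduce
    rw [← integral_const_mul, ← integral_const_mul]
    refine integral_congr_ae (ae_of_all _ fun w => ?_)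
    beta_reduce
    ring
  · refine setIntegral_eq_of_subset_of_forall_sdiff_eq_zero measurableSet_Ioi
      Ioc_subset_Ioi_self fun v hv => ?_
    have hlt : c < v := by
      by_contra! hle
      exact hv.2 ⟨hv.1, hle⟩
    rw [max_eq_right (by linarith), zero_mul]
  · rw [intervalIntegral.integral_of_le hc.le]
    refine setIntegral_congr_fun measurableSet_Ioc fun v hv => ?_
    have := hv.2
    rw [max_eq_left (by linarith)]

/-- For `r ∈ [-1,0)` and the CES unit cost `h(p∘x) = (∑ pᵢ^{-r}xᵢ^{-r})^{-1/r}`, the second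
derivative in `p₀` of the profit function built from the density `φ` equals the Laplace
transform of `f`, evaluated at `(p₁^{-1/r},…,pₙ^{-1/r}, 1)`. -/
theorem ces_profit_second_derivative_laplace
    (n : ℕ) (hn : 0 < n) (r : ℝ) (hr : r ∈ Set.Ico (-1:ℝ) 0)
    (f : (Fin n → ℝ) → ℝ) (hf_cont : Continuous f)
    (hf_growth : ∀ A > (0:ℝ), ∃ C > (0:ℝ), ∀ x : Fin n → ℝ, (∀ i, 0 ≤ x i) →
      |f x| ≤ C * Real.exp (A * ‖x‖))
    (φ : (Fin n → ℝ) → ℝ)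
    (hφ : φ = fun x => (-r) ^ (n - 1) * (∏ i, x i) ^ (-r - 1) *
      ∫ t in Ioi (0:ℝ), t ^ (n - 1) * Real.exp (-t) * f (fun i => t * (x i) ^ (-r)))
    (Pi : (Fin n → ℝ) → ℝ → ℝ)
    (hPi : Pi = fun p p₀ => ∫ x in {x : Fin n → ℝ | ∀ i, 0 ≤ x i},
      max (p₀ - (∑ i, (p i) ^ (-r) * (x i) ^ (-r)) ^ (-1 / r)) 0 * φ x)
    (p : Fin n → ℝ) (hp : ∀ i, 0 < p i) :
    deriv (deriv (fun p₀ => Pi (fun i => (p i) ^ (-1 / r)) p₀)) 1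
      = ∫ x in {x : Fin n → ℝ | ∀ i, 0 ≤ x i},
          Real.exp (-(∑ i, p i * x i)) * f x := by
  obtain ⟨s, rfl⟩ : ∃ s, r = -s := ⟨-r, (neg_neg r).symm⟩
  have hs : 0 < s := by linarith [hr.2]
  have hgrow := fun c (hc : (0 : ℝ) < c) => exists_forall_abs_le_mul_exp_sum hn hf_growth hp hc
  have hae : (volume : Measure (Fin n → ℝ)).restrict {x | ∀ i, 0 ≤ x i} =
      volume.restrict (univ.pi fun _ => Ioi 0) :=
    Measure.restrict_congr_set Measure.univ_pi_Ioi_ae_eq_Ici.symm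
  set G : ℝ → ℝ := fun v => v⁻¹ * ∫ w in univ.pi fun _ : Fin n => Ioi (0 : ℝ),
    exp (-(∑ i, p i * w i) * v ^ (-s)) * f w with hG
  have hPi' : ∀ c > 0, Pi (fun i => p i ^ (-1 / -s)) c = ∫ v in (0 : ℝ)..c, (c - v) * G v := by
    intro c hc
    rw [← ces_profit_eq_intervalIntegral hn hs hf_cont hp hgrow hc, hPi, hφ, hae]
    have hpow : ∀ i, (p i ^ (1 / s)) ^ s = p i := fun i => by
      rw [← rpow_mul (hp i).le, one_div_mul_cancel hs.ne', rpow_one]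
    simp only [neg_neg, neg_div_neg_eq, hpow]
  have hGi : ∀ b > 0, IntervalIntegrable G volume 0 b := by
    intro b hb
    rw [intervalIntegrable_iff_integrableOn_Ioc_of_le hb.le]
    have := (integrable_laplace_kernel hn hs hf_cont hp hgrow hb).integral_prod_left
    simp only [integral_const_mul] at this
    exact this
  have hGc : ∀ b > 0, ContinuousAt G b := fun b hb =>
    continuousAt_laplace_rpow hs hf_cont hp hgrow hb
  have hGm : ∀ b > 0, StronglyMeasurableAtFilter G (nhds b) := fun b hb =>
    ContinuousOn.stronglyMeasurableAtFilter isOpen_Ioi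
      (fun v hv => (hGc v hv).continuousWithinAt) b (show b ∈ Ioi (0 : ℝ) from hb)
  have hd : ∀ c > 0, deriv (fun p₀ => Pi (fun i => p i ^ (-1 / -s)) p₀) c =
      ∫ v in (0 : ℝ)..c, G v := by
    intro c hc
    refine ((hasDerivAt_integral_sub_mul (hGi c hc) (hGm c hc) (hGc c hc) ?_).congr_of_eventuallyEq
      ?_).deriv
    · filter_upwards [Ioi_mem_nhds hc] with u hu using hGi u hu
    · filter_upwards [Ioi_mem_nhds hc] with u hu using hPi' u hu
  have hd2 : deriv (deriv (fun p₀ => Pi (fun i => p i ^ (-1 / -s)) p₀)) 1 = G 1 := by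
    refine ((intervalIntegral.integral_hasDerivAt_right (hGi 1 one_pos) (hGm 1 one_pos)
      (hGc 1 one_pos)).congr_of_eventuallyEq ?_).deriv
    filter_upwards [Ioi_mem_nhds one_pos] with u hu using hd u hu
  rw [hd2, hae, hG]
  simp
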